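/- arXiv:2106.06205 — 14 statements merged into one kernel-verified Lean document; each statement's English description precedes it below -/
import Mathlib

section
/- Let f and g be time warps, and define h : ℕ∞ → ℕ∞ by h(0) = 0, h(n) = ⨆ {q ∈ ℕ∞ ∣ f q ≤ g n} for n ∈ ℕ with n ≠ 0, and h(∞) = ⨆ {q ∈ ℕ∞ ∣ ∃ m ∈ ℕ, f q ≤ g m}. Then h is a time warp, and for every time warp k one has (∀ p, f (k p) ≤ g p) if and only if (∀ p, k p ≤ h p). In particular h is the left residual f\g of g by f. -/
/-- A time warp: a monotone function on `ℕ∞` with `f 0 = 0` and `f ⊤ = ⨆ n : ℕ, f n`. -/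
def IsTimeWarp (f : ℕ∞ → ℕ∞) : Prop :=
  Monotone f ∧ f 0 = 0 ∧ f ⊤ = ⨆ n : ℕ, f n

/-- The left residual `f\g`. -/
noncomputable def lres (f g : ℕ∞ → ℕ∞) : ℕ∞ → ℕ∞ := fun p =>
  if p = 0 then 0
  else if p = ⊤ then sSup {q : ℕ∞ | ∃ m : ℕ, f q ≤ g (m : ℕ∞)}
  else sSup {q : ℕ∞ | f q ≤ g p}

/-- The right residual `g/f`. -/
noncomputable def rres (g f : ℕ∞ → ℕ∞) : ℕ∞ → ℕ∞ := fun p =>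
  sInf (g '' {q : ℕ∞ | p ≤ f q})

/-- The greatest time warp `⊤`. -/
noncomputable def twTop : ℕ∞ → ℕ∞ := fun p => if p = 0 then 0 else ⊤

/-- `last f`. -/
noncomputable def lastTW (f : ℕ∞ → ℕ∞) : ℕ∞ := sInf {p : ℕ∞ | f p = f ⊤}

namespace IsTimeWarp

theorem map_sSup_le {f : ℕ∞ → ℕ∞} (hf : IsTimeWarp f) {S : Set ℕ∞} {a : ℕ∞}
    (h : ∀ q ∈ S, f q ≤ a) : f (sSup S) ≤ a := by
  obtain ⟨mono, zero, top⟩ := hf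
  rcases S.eq_empty_or_nonempty with rfl | hS
  · simp [zero]
  by_cases htop : sSup S = ⊤
  · rw [htop, top]
    refine iSup_le fun n => ?_
    obtain ⟨q, hq, hnq⟩ := lt_sSup_iff.1 (htop ▸ ENat.natCast_lt_top n)
    exact (mono hnq.le).trans (h q hq)
  · have := hS.to_subtype
    exact h _ (ENat.sSup_mem_of_nonempty_of_lt_top (lt_top_iff_ne_top.2 htop))

theorem map_iSup_le {f : ℕ∞ → ℕ∞} (hf : IsTimeWarp f) {ι : Type*} {u : ι → ℕ∞} {a : ℕ∞}
    (h : ∀ i, f (u i) ≤ a) : f (⨆ i, u i) ≤ a :=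
  hf.map_sSup_le (by rintro _ ⟨i, rfl⟩; exact h i)

end IsTimeWarp

theorem lres_zero (f g : ℕ∞ → ℕ∞) : lres f g 0 = 0 := by simp [lres]

theorem lres_natCast (f g : ℕ∞ → ℕ∞) {n : ℕ} (hn : n ≠ 0) :
    lres f g n = sSup {q : ℕ∞ | f q ≤ g n} := by simp [lres, hn]

theorem lres_top (f g : ℕ∞ → ℕ∞) :
    lres f g ⊤ = sSup {q : ℕ∞ | ∃ m : ℕ, f q ≤ g m} := by simp [lres]

theorem isTimeWarp_lres (f : ℕ∞ → ℕ∞) {g : ℕ∞ → ℕ∞} (hg : Monotone g) :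
    IsTimeWarp (lres f g) := by
  have le_top (n : ℕ) : lres f g n ≤ lres f g ⊤ := by
    rcases eq_or_ne n 0 with rfl | hn
    · simp [lres_zero]
    · rw [lres_natCast f g hn, lres_top]
      exact sSup_le_sSup fun q hq => ⟨n, hq⟩
  refine ⟨fun p r hpr => ?_, lres_zero f g, le_antisymm ?_ (iSup_le le_top)⟩
  · induction r using ENat.recTopCoe with
    | top =>
      induction p using ENat.recTopCoe with
      | top => exact le_rfl
      | coe n => exact le_top n
    | coe m =>
      lift p to ℕ using ne_top_of_le_ne_top (ENat.natCast_ne_top m) hpr with n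
      rcases eq_or_ne n 0 with rfl | hn
      · simp [lres_zero]
      · have hm : m ≠ 0 := by
          have : n ≤ m := by exact_mod_cast hpr
          omega
        rw [lres_natCast f g hn, lres_natCast f g hm]
        exact sSup_le_sSup fun q hq => le_trans hq (hg hpr)
  · rw [lres_top]
    refine sSup_le ?_
    rintro q ⟨m, hq⟩
    refine le_iSup_of_le (m + 1) ?_
    rw [lres_natCast f g m.succ_ne_zero]
    exact le_sSup (hq.trans (hg (by exact_mod_cast m.le_succ)))

theorem map_lres_natCast_le {f : ℕ∞ → ℕ∞} (hf : IsTimeWarp f) (g : ℕ∞ → ℕ∞) (n : ℕ) :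
    f (lres f g n) ≤ g n := by
  rcases eq_or_ne n 0 with rfl | hn
  · simp [lres_zero, hf.2.1]
  · rw [lres_natCast f g hn]
    exact hf.map_sSup_le fun q hq => hq

theorem stmt0 (f g : ℕ∞ → ℕ∞) (hf : IsTimeWarp f) (hg : IsTimeWarp g) :
    IsTimeWarp (lres f g) ∧
      ∀ k : ℕ∞ → ℕ∞, IsTimeWarp k →
        ((∀ p : ℕ∞, f (k p) ≤ g p) ↔ (∀ p : ℕ∞, k p ≤ lres f g p)) := by
  have hl := isTimeWarp_lres f hg.1
  refine ⟨hl, fun k hk => ⟨fun h p => ?_, fun h p => ?_⟩⟩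
  · have le_natCast (n : ℕ) : k n ≤ lres f g n := by
      rcases eq_or_ne n 0 with rfl | hn
      · simp [hk.2.1]
      · rw [lres_natCast f g hn]
        exact le_sSup (h n)
    induction p using ENat.recTopCoe with
    | top =>
      rw [hk.2.2, hl.2.2]
      exact iSup_mono le_natCast
    | coe n => exact le_natCast n
  · have map_le (n : ℕ) : f (k n) ≤ g n := (hf.1 (h n)).trans (map_lres_natCast_le hf g n)
    induction p using ENat.recTopCoe with
    | top =>
      rw [hk.2.2]
      exact hf.map_iSup_le fun n => (map_le n).trans (hg.1 le_top)
    | coe n => exact map_le n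
end

section
/- Let f and g be time warps, and define h : ℕ∞ → ℕ∞ by h(p) = ⨅ {g q ∣ q ∈ ℕ∞, p ≤ f q}. Then h is a time warp, and for every time warp k one has (∀ p, k (f p) ≤ g p) if and only if (∀ p, k p ≤ h p). In particular h is the right residual g/f of g by f. -/
theorem rres_le {f g : ℕ∞ → ℕ∞} {p q : ℕ∞} (h : p ≤ f q) : rres g f p ≤ g q :=
  sInf_le ⟨q, h, rfl⟩

theorem le_rres_iff {f g : ℕ∞ → ℕ∞} {p a : ℕ∞} :
    a ≤ rres g f p ↔ ∀ q, p ≤ f q → a ≤ g q := by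
  simp [rres, le_sInf_iff]

theorem rres_mono (f g : ℕ∞ → ℕ∞) : Monotone (rres g f) := fun _ _ h =>
  le_rres_iff.2 fun _ hq => rres_le (h.trans hq)

/-- If `f a` is finite and `r` is a lower bound of the points strictly greater than `a`, then `g r`
is at most the supremum of `rres g f` over the natural numbers. -/
theorem le_iSup_rres {f g : ℕ∞ → ℕ∞} (hf : Monotone f) (hg : Monotone g) {a r : ℕ∞}
    (ha : f a ≠ ⊤) (hr : ∀ q, a < q → r ≤ q) : g r ≤ ⨆ n : ℕ, rres g f n := by
  obtain ⟨m, hm⟩ := ENat.ne_top_iff_exists.1 ha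
  refine le_trans (le_rres_iff.2 fun q hq => hg (hr q ?_))
    (le_iSup (fun n : ℕ => rres g f n) (m + 1))
  by_contra! hqa
  have h := hq.trans (hf hqa)
  rw [← hm, Nat.cast_le] at h
  omega

theorem rres_top_le {f g : ℕ∞ → ℕ∞} (hf : IsTimeWarp f) (hg : IsTimeWarp g) :
    rres g f ⊤ ≤ ⨆ n : ℕ, rres g f n := by
  obtain ⟨hfm, hf0, -⟩ := hf
  obtain ⟨hgm, -, hgt⟩ := hg
  by_cases hfin : ∃ n : ℕ, f n = ⊤
  · classical
    obtain ⟨j, hj⟩ : ∃ j, Nat.find hfin = j + 1 := Nat.exists_eq_succ_of_ne_zero fun h0 => by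
      have h := Nat.find_spec hfin
      simp [h0, hf0] at h
    have hspec := Nat.find_spec hfin
    rw [hj] at hspec
    refine (rres_le hspec.ge).trans
      (le_iSup_rres hfm hgm (a := j) (Nat.find_min hfin (by omega)) fun q hq => ?_)
    rw [Nat.cast_add_one]
    exact Order.add_one_le_of_lt hq
  · push Not at hfin
    by_cases htop : f ⊤ = ⊤
    · refine (rres_le htop.ge).trans ?_
      rw [hgt]
      exact iSup_le fun n => le_iSup_rres hfm hgm (hfin n) fun q hq => hq.le
    · obtain ⟨m, hm⟩ := ENat.ne_top_iff_exists.1 htop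
      refine le_trans (le_rres_iff.2 fun q hq => ?_)
        (le_iSup (fun n : ℕ => rres g f n) (m + 1))
      have h := hq.trans (hfm le_top)
      rw [← hm, Nat.cast_le] at h
      omega

theorem stmt1 (f g : ℕ∞ → ℕ∞) (hf : IsTimeWarp f) (hg : IsTimeWarp g) :
    IsTimeWarp (rres g f) ∧
      ∀ k : ℕ∞ → ℕ∞, IsTimeWarp k →
        ((∀ p : ℕ∞, k (f p) ≤ g p) ↔ (∀ p : ℕ∞, k p ≤ rres g f p)) := by
  refine ⟨⟨rres_mono f g, ?_, (rres_top_le hf hg).antisymm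
    (iSup_le fun n => rres_mono f g le_top)⟩, fun k hk => ⟨fun h p => ?_, fun h p => ?_⟩⟩
  · exact le_antisymm ((rres_le (zero_le : 0 ≤ f 0)).trans hg.2.1.le) zero_le
  · exact le_rres_iff.2 fun q hq => (hk.1 hq).trans (h q)
  · exact (h (f p)).trans (rres_le le_rfl)
end

section
/- For all time warps f, g, h: f\(g ⊓ h) = (f\g) ⊓ (f\h) (as functions on ℕ∞), where ⊓ is the pointwise meet. -/
/-- In a complete linear order, suprema of lower sets turn intersections into meets. -/
theorem IsLowerSet.sSup_inter {α : Type*} [CompleteLinearOrder α] {s t : Set α}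
    (hs : IsLowerSet s) (ht : IsLowerSet t) : sSup (s ∩ t) = sSup s ⊓ sSup t := by
  rcases hs.total ht with h | h
  · rw [Set.inter_eq_left.2 h, inf_eq_left.2 (sSup_le_sSup h)]
  · rw [Set.inter_eq_right.2 h, inf_eq_right.2 (sSup_le_sSup h)]

theorem stmt3 (f g h : ℕ∞ → ℕ∞) (hf : IsTimeWarp f) (hg : IsTimeWarp g)
    (hh : IsTimeWarp h) :
    lres f (g ⊓ h) = lres f g ⊓ lres f h := by
  have lower_le (b : ℕ∞) : IsLowerSet {q | f q ≤ b} := fun _ _ hle hq => (hf.1 hle).trans hq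
  have lower_exists (k : ℕ∞ → ℕ∞) : IsLowerSet {q | ∃ m : ℕ, f q ≤ k m} :=
    fun _ _ hle ⟨m, hm⟩ => ⟨m, (hf.1 hle).trans hm⟩
  funext p
  simp only [lres, Pi.inf_apply]
  split_ifs with h0 htop
  · simp
  · rw [← (lower_exists g).sSup_inter (lower_exists h)]
    congr 1
    ext q
    constructor
    · rintro ⟨m, hm⟩
      exact ⟨⟨m, hm.trans inf_le_left⟩, ⟨m, hm.trans inf_le_right⟩⟩
    · rintro ⟨⟨m, hm⟩, ⟨n, hn⟩⟩
      refine ⟨max m n, le_inf (hm.trans (hg.1 ?_)) (hn.trans (hh.1 ?_))⟩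
      · exact_mod_cast le_max_left m n
      · exact_mod_cast le_max_right m n
  · rw [← (lower_le (g p)).sSup_inter (lower_le (h p))]
    congr 1
    ext q
    simp
end

section
/- For all time warps f, g, h: (g ⊓ h)\f = (g\f) ⊔ (h\f) (as functions on ℕ∞), where ⊓ and ⊔ are the pointwise meet and join. -/
theorem stmt4 (f g h : ℕ∞ → ℕ∞) (hf : IsTimeWarp f) (hg : IsTimeWarp g)
    (hh : IsTimeWarp h) :
    lres (g ⊓ h) f = lres g f ⊔ lres h f := by
  funext p
  simp only [lres, Pi.sup_apply, Pi.inf_apply, inf_le_iff, exists_or, Set.ofPred_or, sSup_union]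
  split_ifs <;> simp
end

section
/- For all time warps f, g, h: f\(g ⊔ h) = (f\g) ⊔ (f\h) (as functions on ℕ∞), where ⊔ is the pointwise join. -/
theorem stmt5 (f g h : ℕ∞ → ℕ∞) (hf : IsTimeWarp f) (hg : IsTimeWarp g)
    (hh : IsTimeWarp h) :
    lres f (g ⊔ h) = lres f g ⊔ lres f h := by
  funext p
  simp only [lres, Pi.sup_apply]
  split_ifs
  · simp
  · simp only [le_sup_iff, exists_or, Set.ofPred_or, sSup_union]
  · simp only [le_sup_iff, Set.ofPred_or, sSup_union]
end

section
/- For all time warps f, g, h: f/(g ⊓ h) = (f/g) ⊔ (f/h) (as functions on ℕ∞), where ⊓ and ⊔ are the pointwise meet and join. -/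
/-- On a linear order, the infimum of the image of an intersection of two upper sets is the
maximum of the infima, because one upper set contains the other. -/
theorem sInf_image_inter_of_isUpperSet {α β : Type*} [LinearOrder α] [CompleteLattice β]
    {s t : Set α} (hs : IsUpperSet s) (ht : IsUpperSet t) (f : α → β) :
    sInf (f '' (s ∩ t)) = sInf (f '' s) ⊔ sInf (f '' t) := by
  rcases hs.total ht with hst | hts
  · rw [Set.inter_eq_left.mpr hst, sup_eq_left.mpr (sInf_le_sInf (Set.image_mono hst))]
  · rw [Set.inter_eq_right.mpr hts, sup_eq_right.mpr (sInf_le_sInf (Set.image_mono hts))]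

theorem stmt8 (f g h : ℕ∞ → ℕ∞) (hf : IsTimeWarp f) (hg : IsTimeWarp g)
    (hh : IsTimeWarp h) :
    rres f (g ⊓ h) = rres f g ⊔ rres f h := by
  funext p
  have key := sInf_image_inter_of_isUpperSet
    (s := {q | p ≤ g q}) (t := {q | p ≤ h q})
    (fun _ _ hab ha => ha.trans (hg.1 hab)) (fun _ _ hab ha => ha.trans (hh.1 hab)) f
  simpa only [rres, Pi.sup_apply, Pi.inf_apply, le_inf_iff, Set.ofPred_and] using key
end

section
/- For all time warps f, g, h: (g ⊔ h)/f = (g/f) ⊔ (h/f) (as functions on ℕ∞), where ⊔ is the pointwise join. -/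
theorem rres_apply_eq_of_isLeast {f g : ℕ∞ → ℕ∞} (hg : Monotone g) {p q : ℕ∞}
    (hq : IsLeast {q : ℕ∞ | p ≤ f q} q) : rres g f p = g q :=
  (hg.map_isLeast hq).csInf_eq

theorem stmt9 (f g h : ℕ∞ → ℕ∞) (hf : IsTimeWarp f) (hg : IsTimeWarp g)
    (hh : IsTimeWarp h) :
    rres (g ⊔ h) f = rres g f ⊔ rres h f := by
  funext p
  rcases Set.eq_empty_or_nonempty {q : ℕ∞ | p ≤ f q} with hempty | hne
  · simp [rres, hempty]
  · have hq : IsLeast {q : ℕ∞ | p ≤ f q} (sInf {q : ℕ∞ | p ≤ f q}) :=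
      ⟨csInf_mem hne, fun _ => sInf_le⟩
    rw [Pi.sup_apply, rres_apply_eq_of_isLeast (hg.1.sup hh.1) hq,
      rres_apply_eq_of_isLeast hg.1 hq, rres_apply_eq_of_isLeast hh.1 hq, Pi.sup_apply]
end

section
/- For all time warps f and g: f\g = (fʳ ∘ g) ⊔ (⊤ ∘ f)ʳ ⊔ gᵒ (as functions on ℕ∞), where ⊔ is the pointwise join and ∘ is composition. -/
/-- Away from `0`, both remaining clauses of `lres` are one supremum over finite bounds. -/
theorem lres_of_ne_zero {f g : ℕ∞ → ℕ∞} (hg : Monotone g) {p : ℕ∞} (hp : p ≠ 0) :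
    lres f g p = sSup {q : ℕ∞ | ∃ m : ℕ, (m : ℕ∞) ≤ p ∧ f q ≤ g m} := by
  unfold lres
  rw [if_neg hp]
  split_ifs with h
  · simp [h]
  · congr 1
    ext q
    constructor
    · intro hq
      lift p to ℕ using h
      exact ⟨p, le_rfl, hq⟩
    · rintro ⟨m, hm, hq⟩
      exact hq.trans (hg hm)

theorem le_lres {f g : ℕ∞ → ℕ∞} (hg : Monotone g) {p q : ℕ∞} (hp : p ≠ 0) {m : ℕ}
    (hm : (m : ℕ∞) ≤ p) (hq : f q ≤ g m) : q ≤ lres f g p := by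
  rw [lres_of_ne_zero hg hp]
  exact le_sSup ⟨m, hm, hq⟩

theorem lres_le {f g : ℕ∞ → ℕ∞} (hg : Monotone g) {p b : ℕ∞}
    (h : ∀ q : ℕ∞, ∀ m : ℕ, p ≠ 0 → (m : ℕ∞) ≤ p → f q ≤ g m → q ≤ b) :
    lres f g p ≤ b := by
  rcases eq_or_ne p 0 with rfl | hp
  · simp [lres_zero]
  · rw [lres_of_ne_zero hg hp]
    exact sSup_le fun q ⟨m, hm, hq⟩ => h q m hp hm hq

theorem IsTimeWarp.exists_nat_le {g : ℕ∞ → ℕ∞} (hg : IsTimeWarp g) {p : ℕ∞} {n : ℕ}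
    (h : (n : ℕ∞) ≤ g p) : ∃ m : ℕ, (m : ℕ∞) ≤ p ∧ (n : ℕ∞) ≤ g m := by
  induction p with
  | coe p => exact ⟨p, le_rfl, h⟩
  | top =>
    rw [hg.2.2] at h
    cases n with
    | zero => exact ⟨0, by simp, by simp⟩
    | succ k =>
      have hk : (k : ℕ∞) < ⨆ m : ℕ, g m := lt_of_lt_of_le (by exact_mod_cast k.lt_succ_self) h
      obtain ⟨m, hm⟩ := lt_iSup_iff.mp hk
      exact ⟨m, le_top, by simpa using Order.add_one_le_of_lt hm⟩

theorem twTop_eq_zero_of_le_nat {x : ℕ∞} {m : ℕ} (h : twTop x ≤ m) : x = 0 := by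
  by_contra hx
  simp [twTop, hx] at h

theorem stmt11 (f g : ℕ∞ → ℕ∞) (hf : IsTimeWarp f) (hg : IsTimeWarp g) :
    lres f g = (lres f id ∘ g) ⊔ lres (twTop ∘ f) id ⊔ lres twTop g := by
  have hid : Monotone (id : ℕ∞ → ℕ∞) := monotone_id
  funext p
  simp only [Pi.sup_apply, Function.comp_apply]
  apply le_antisymm
  · refine lres_le hg.1 fun q m hp hm hq => ?_
    rcases eq_or_ne (g m) 0 with h0 | h0
    · have hfq : f q = 0 := by simpa [h0] using hq
      refine le_sup_of_le_left (le_sup_of_le_right (le_lres hid hp (m := 0) (by simp) ?_))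
      simp [twTop, hfq]
    · rcases eq_or_ne (g m) ⊤ with ht | ht
      · exact le_sup_of_le_right (le_lres hg.1 hp hm (by simp [ht]))
      · obtain ⟨n, hn⟩ := ENat.ne_top_iff_exists.mp ht
        have hmp : g m ≤ g p := hg.1 hm
        have hgp : g p ≠ 0 := fun h => h0 (by simpa [h] using hmp)
        refine le_sup_of_le_left (le_sup_of_le_left
          (le_lres hid hgp (m := n) (hn.trans_le hmp) ?_))
        simpa [hn] using hq
  · refine sup_le (sup_le ?_ ?_) ?_
    · refine lres_le hid fun q n hgp hn hq => ?_
      have hp : p ≠ 0 := by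
        rintro rfl
        exact hgp hg.2.1
      obtain ⟨m, hm, hnm⟩ := hg.exists_nat_le hn
      exact le_lres hg.1 hp hm (le_trans hq hnm)
    · refine lres_le hid fun q n hp _ hq => ?_
      have hfq : f q = 0 := twTop_eq_zero_of_le_nat hq
      exact le_lres hg.1 hp (m := 0) (by simp) (by simp [hfq])
    · refine lres_le hg.1 fun q m hp hm hq => le_lres hg.1 hp hm ?_
      rcases eq_or_ne q 0 with rfl | h0
      · simp [hf.2.1]
      · have ht : g m = ⊤ := by simpa [twTop, h0] using hq
        simp [ht]
end

section
/- For all time warps f and g: g/f = (g ∘ fˡ) ⊔ (fˡ)ᵒ (as functions on ℕ∞), where ⊔ is the pointwise join and ∘ is composition. -/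
theorem rres_eq_comp_of_le {f : ℕ∞ → ℕ∞} (g : ℕ∞ → ℕ∞) (hg : Monotone g) {p : ℕ∞}
    (hp : p ≤ f ⊤) : rres g f p = g (rres id f p) := by
  have hne : {q : ℕ∞ | p ≤ f q}.Nonempty := ⟨⊤, hp⟩
  have hmem : sInf {q : ℕ∞ | p ≤ f q} ∈ {q : ℕ∞ | p ≤ f q} := csInf_mem hne
  simp only [rres, Set.image_id]
  apply le_antisymm
  · exact sInf_le ⟨_, hmem, rfl⟩
  · apply le_sInf
    rintro _ ⟨q, hq, rfl⟩
    exact hg (sInf_le hq)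

theorem rres_eq_top_of_not_le {f : ℕ∞ → ℕ∞} (g : ℕ∞ → ℕ∞) (hf : Monotone f) {p : ℕ∞}
    (hp : ¬ p ≤ f ⊤) : rres g f p = ⊤ := by
  have hempty : {q : ℕ∞ | p ≤ f q} = ∅ :=
    Set.eq_empty_of_forall_notMem fun q hq => hp (le_trans hq (hf le_top))
  simp [rres, hempty]

theorem rres_id_ne_top {f : ℕ∞ → ℕ∞} (hf : IsTimeWarp f) {m : ℕ} (hm : (m : ℕ∞) ≤ f ⊤) :
    rres id f m ≠ ⊤ := by
  obtain ⟨n, hn⟩ : ∃ n : ℕ, (m : ℕ∞) ≤ f n := by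
    by_contra! h
    cases m with
    | zero => simpa using h 0
    | succ k =>
      have hle : f ⊤ ≤ (k : ℕ∞) := by
        rw [hf.2.2]
        refine iSup_le fun n => Order.le_of_lt_add_one ?_
        exact_mod_cast h n
      have : ((k + 1 : ℕ) : ℕ∞) ≤ (k : ℕ∞) := hm.trans hle
      exact absurd (Nat.cast_le.mp this) (by omega)
  refine ne_top_of_le_ne_top (ENat.natCast_ne_top n) ?_
  exact sInf_le ⟨_, hn, rfl⟩

theorem eq_zero_of_twTop_le {q r : ℕ∞} (hr : r ≠ ⊤) (h : twTop q ≤ r) : q = 0 := by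
  by_contra hq
  exact hr (top_le_iff.mp (by simpa [twTop, hq] using h))

theorem lres_twTop_rres_eq_zero {f : ℕ∞ → ℕ∞} (hf : IsTimeWarp f) {p : ℕ∞} (hp : p ≤ f ⊤) :
    lres twTop (rres id f) p = 0 := by
  unfold lres
  split_ifs with h0 ht
  · rfl
  · refine le_antisymm (sSup_le ?_) bot_le
    rintro q ⟨m, hq⟩
    exact (eq_zero_of_twTop_le (rres_id_ne_top hf (le_trans (ht ▸ le_top) hp)) hq).le
  · lift p to ℕ using ht
    refine le_antisymm (sSup_le fun q hq => ?_) bot_le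
    exact (eq_zero_of_twTop_le (rres_id_ne_top hf hp) hq).le

theorem lres_twTop_rres_eq_top {f : ℕ∞ → ℕ∞} (hf : Monotone f) {p : ℕ∞} (hp : ¬ p ≤ f ⊤) :
    lres twTop (rres id f) p = ⊤ := by
  unfold lres
  split_ifs with h0 ht
  · exact absurd (h0 ▸ bot_le) hp
  · refine top_le_iff.mp (le_sSup ?_)
    obtain ⟨n, hn⟩ := ENat.ne_top_iff_exists.mp fun h => hp (le_top.trans_eq h.symm)
    refine ⟨n + 1, ?_⟩
    rw [rres_eq_top_of_not_le id hf]
    · exact le_top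
    · rw [← hn, Nat.cast_le]
      omega
  · refine top_le_iff.mp (le_sSup ?_)
    rw [Set.mem_ofPred_eq, rres_eq_top_of_not_le id hf hp]
    exact le_top

theorem stmt12 (f g : ℕ∞ → ℕ∞) (hf : IsTimeWarp f) (hg : IsTimeWarp g) :
    rres g f = (g ∘ rres id f) ⊔ lres twTop (rres id f) := by
  funext p
  rw [Pi.sup_apply, Function.comp_apply]
  by_cases hp : p ≤ f ⊤
  · rw [lres_twTop_rres_eq_zero hf hp, rres_eq_comp_of_le g hg.1 hp]
    exact (sup_of_le_left bot_le).symm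
  · rw [lres_twTop_rres_eq_top hf.1 hp, rres_eq_top_of_not_le g hf.1 hp, sup_top_eq]
end

section
/- For any time warp f and any n ∈ ℕ with n ≠ 0 (viewed in ℕ∞): (i) fᵒ n = 0 if and only if f n < ∞; (ii) fᵒ n = ∞ if and only if f n = ∞; (iii) fᵒ ∞ = 0 if and only if f k < ∞ for all k ∈ ℕ; (iv) fᵒ ∞ = ∞ if and only if f k = ∞ for some k ∈ ℕ. -/
theorem twTop_le_iff {q x : ℕ∞} : twTop q ≤ x ↔ q = 0 ∨ x = ⊤ := by
  unfold twTop
  split_ifs with h <;> simp [h]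

theorem sSup_setOf_eq_zero_or (P : Prop) [Decidable P] :
    sSup {q : ℕ∞ | q = 0 ∨ P} = if P then ⊤ else 0 := by
  split_ifs with h <;> simp [h]

open Classical in
theorem lres_twTop_natCast (f : ℕ∞ → ℕ∞) {n : ℕ} (hn : n ≠ 0) :
    lres twTop f n = if f n = ⊤ then ⊤ else 0 := by
  simp [lres, hn, twTop_le_iff, sSup_setOf_eq_zero_or]

open Classical in
theorem lres_twTop_top (f : ℕ∞ → ℕ∞) :
    lres twTop f ⊤ = if ∃ k : ℕ, f k = ⊤ then ⊤ else 0 := by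
  simp only [lres, ENat.top_ne_zero, if_false, if_true, twTop_le_iff, exists_or, exists_const,
    sSup_setOf_eq_zero_or]

theorem stmt13 (f : ℕ∞ → ℕ∞) (hf : IsTimeWarp f) (n : ℕ) (hn : n ≠ 0) :
    (lres twTop f (n : ℕ∞) = 0 ↔ f (n : ℕ∞) < ⊤) ∧
    (lres twTop f (n : ℕ∞) = ⊤ ↔ f (n : ℕ∞) = ⊤) ∧
    (lres twTop f ⊤ = 0 ↔ ∀ k : ℕ, f (k : ℕ∞) < ⊤) ∧
    (lres twTop f ⊤ = ⊤ ↔ ∃ k : ℕ, f (k : ℕ∞) = ⊤) := by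
  rw [lres_twTop_natCast f hn, lres_twTop_top]
  simp [lt_top_iff_ne_top]
end

section
/- For any time warp f, any n ∈ ℕ with n ≠ 0, and any m ∈ ℕ (all viewed in ℕ∞): (i) fʳ n = m if and only if f m ≤ n < f (m+1); (ii) fʳ n = ∞ if and only if f ∞ ≤ n; (iii) fʳ ∞ = m if and only if f (m+1) = ∞ and fʳ k = m for some k ∈ ℕ; (iv) fʳ ∞ = ∞ if and only if f ∞ < ∞, or f ∞ = ∞ and f k < ∞ for all k ∈ ℕ. -/
theorem IsLowerSet.enat_sSup_eq_top_iff {S : Set ℕ∞} (hS : IsLowerSet S) :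
    sSup S = ⊤ ↔ ∀ k : ℕ, (k : ℕ∞) ∈ S := by
  constructor
  · intro h k
    obtain ⟨q, hq, hkq⟩ := lt_sSup_iff.1 (h ▸ ENat.natCast_lt_top k)
    exact hS hkq.le hq
  · intro h
    rw [ENat.eq_top_iff_forall_ge]
    exact fun k => le_sSup (h k)

theorem IsLowerSet.enat_sSup_eq_natCast_iff {S : Set ℕ∞} (hS : IsLowerSet S)
    (h0 : (0 : ℕ∞) ∈ S) (m : ℕ) :
    sSup S = m ↔ (m : ℕ∞) ∈ S ∧ (m : ℕ∞) + 1 ∉ S := by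
  have hlt : (m : ℕ∞) < m + 1 := by exact_mod_cast Nat.lt_succ_self m
  constructor
  · intro h
    refine ⟨?_, fun hm => (h ▸ le_sSup hm).not_gt hlt⟩
    cases m with
    | zero => simpa using h0
    | succ j =>
      have hj : (j : ℕ∞) < sSup S := by
        rw [h]
        exact_mod_cast Nat.lt_succ_self j
      obtain ⟨q, hq, hjq⟩ := lt_sSup_iff.1 hj
      refine hS ?_ hq
      push_cast
      exact Order.add_one_le_of_lt hjq
  · rintro ⟨hm, hm'⟩
    refine le_antisymm (sSup_le fun q hq => ?_) (le_sSup hm)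
    by_contra! hmq
    exact hm' (hS (Order.add_one_le_of_lt hmq) hq)

theorem lres_id_natCast (f : ℕ∞ → ℕ∞) {n : ℕ} (hn : n ≠ 0) :
    lres f id n = sSup {q : ℕ∞ | f q ≤ n} := by
  simp [lres, hn]

theorem lres_id_top (f : ℕ∞ → ℕ∞) : lres f id ⊤ = sSup {q : ℕ∞ | f q < ⊤} := by
  have h (a : ℕ∞) : (∃ m : ℕ, a ≤ m) ↔ a < ⊤ :=
    ⟨fun ⟨m, hm⟩ => hm.trans_lt (ENat.natCast_lt_top m),
      fun ha => ⟨a.toNat, (ENat.natCast_toNat ha.ne).ge⟩⟩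
  simp only [lres, id, h]
  simp

theorem stmt14 (f : ℕ∞ → ℕ∞) (hf : IsTimeWarp f) (n : ℕ) (hn : n ≠ 0) (m : ℕ) :
    (lres f id (n : ℕ∞) = (m : ℕ∞) ↔
      f (m : ℕ∞) ≤ (n : ℕ∞) ∧ (n : ℕ∞) < f ((m : ℕ∞) + 1)) ∧
    (lres f id (n : ℕ∞) = ⊤ ↔ f ⊤ ≤ (n : ℕ∞)) ∧
    (lres f id ⊤ = (m : ℕ∞) ↔
      f ((m : ℕ∞) + 1) = ⊤ ∧ ∃ k : ℕ, lres f id (k : ℕ∞) = (m : ℕ∞)) ∧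
    (lres f id ⊤ = ⊤ ↔
      f ⊤ < ⊤ ∨ (f ⊤ = ⊤ ∧ ∀ k : ℕ, f (k : ℕ∞) < ⊤)) := by
  obtain ⟨hmono, h0, htop⟩ := hf
  have hle (n : ℕ) : IsLowerSet {q : ℕ∞ | f q ≤ n} := fun a b hba ha => (hmono hba).trans ha
  have hfin : IsLowerSet {q : ℕ∞ | f q < ⊤} := fun a b hba ha => (hmono hba).trans_lt ha
  have hnat (n : ℕ) (hn : n ≠ 0) : lres f id (n : ℕ∞) = (m : ℕ∞) ↔
      f (m : ℕ∞) ≤ (n : ℕ∞) ∧ (n : ℕ∞) < f ((m : ℕ∞) + 1) := by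
    rw [lres_id_natCast f hn, (hle n).enat_sSup_eq_natCast_iff (by simp [h0])]
    simp
  refine ⟨hnat n hn, ?_, ?_, ?_⟩
  · rw [lres_id_natCast f hn, (hle n).enat_sSup_eq_top_iff, htop, iSup_le_iff]
    rfl
  · rw [lres_id_top, hfin.enat_sSup_eq_natCast_iff (by simp [h0])]
    simp only [Set.mem_ofPred_eq, not_lt, top_le_iff]
    rw [and_comm]
    refine and_congr_right fun hm => ⟨fun h => ?_, ?_⟩
    · refine ⟨(f m).toNat + 1, (hnat _ (Nat.succ_ne_zero _)).2 ⟨?_, ?_⟩⟩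
      · push_cast
        rw [ENat.natCast_toNat h.ne]
        exact le_self_add
      · rw [hm]
        exact ENat.natCast_lt_top _
    · rintro ⟨k, hk⟩
      rcases eq_or_ne k 0 with rfl | hk0
      · have hm0 : (m : ℕ∞) = 0 := by simpa [lres] using hk.symm
        simp [hm0, h0]
      · exact ((hnat k hk0).1 hk).1.trans_lt (ENat.natCast_lt_top k)
  · rw [lres_id_top, hfin.enat_sSup_eq_top_iff]
    constructor
    · intro h
      rcases eq_or_ne (f ⊤) ⊤ with ht | ht
      · exact Or.inr ⟨ht, h⟩
      · exact Or.inl ht.lt_top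
    · rintro (ht | ⟨-, h⟩) k
      · exact (hmono le_top).trans_lt ht
      · exact h k
end

section
/- For any time warp f, any n ∈ ℕ with n ≠ 0, and any m ∈ ℕ (all viewed in ℕ∞): (i) fˡ n = m if and only if m ≠ 0 and f (m-1) < n ≤ f m; (ii) fˡ n = ∞ if and only if f ∞ < n; (iii) fˡ ∞ = m if and only if f m = ∞ and fˡ k = m for some k ∈ ℕ; (iv) fˡ ∞ = ∞ if and only if f ∞ < ∞, or f ∞ = ∞ and f k < ∞ for all k ∈ ℕ. -/
theorem rres_id_le_coe_iff {f : ℕ∞ → ℕ∞} (hf : Monotone f) (p : ℕ∞) (m : ℕ) :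
    rres id f p ≤ (m : ℕ∞) ↔ p ≤ f m := by
  simp only [rres, Set.image_id]
  refine ⟨fun h => ?_, fun h => sInf_le h⟩
  have hne : {q : ℕ∞ | p ≤ f q}.Nonempty := by
    by_contra hempty
    rw [Set.not_nonempty_iff_eq_empty.mp hempty, sInf_empty] at h
    exact absurd h (by simp)
  exact (csInf_mem hne).trans (hf h)

theorem rres_id_eq_top_iff {f : ℕ∞ → ℕ∞} (hf : Monotone f) (p : ℕ∞) :
    rres id f p = ⊤ ↔ ∀ k : ℕ, f k < p := by
  simp only [ENat.eq_top_iff_forall_gt, ← not_le, rres_id_le_coe_iff hf]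

theorem rres_id_eq_coe_iff {f : ℕ∞ → ℕ∞} (hf : Monotone f) (h0 : f 0 = 0) {p : ℕ∞}
    (hp : p ≠ 0) (m : ℕ) :
    rres id f p = (m : ℕ∞) ↔ m ≠ 0 ∧ f ((m - 1 : ℕ) : ℕ∞) < p ∧ p ≤ f m := by
  rw [le_antisymm_iff, rres_id_le_coe_iff hf]
  cases m with
  | zero => simp [h0, hp]
  | succ j =>
    have h : ((j + 1 : ℕ) : ℕ∞) ≤ rres id f p ↔ f j < p := by
      rw [Nat.cast_add, Nat.cast_one, ENat.add_one_le_iff (ENat.natCast_ne_top j), ← not_le,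
        rres_id_le_coe_iff hf, not_le]
    rw [h]
    simp [and_comm]

theorem IsTimeWarp.coe_le_apply_top_iff {f : ℕ∞ → ℕ∞} (hf : IsTimeWarp f) {n : ℕ}
    (hn : n ≠ 0) : (n : ℕ∞) ≤ f ⊤ ↔ ∃ k : ℕ, (n : ℕ∞) ≤ f k := by
  refine ⟨fun h => ?_, fun ⟨k, hk⟩ => hk.trans (hf.1 le_top)⟩
  obtain ⟨j, rfl⟩ := Nat.exists_eq_succ_of_ne_zero hn
  rw [Nat.succ_eq_add_one, Nat.cast_add, Nat.cast_one] at *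
  rw [ENat.add_one_le_iff (ENat.natCast_ne_top j), hf.2.2, lt_iSup_iff] at h
  exact h.imp fun k hk => (ENat.add_one_le_iff (ENat.natCast_ne_top j)).mpr hk

theorem stmt15 (f : ℕ∞ → ℕ∞) (hf : IsTimeWarp f) (n : ℕ) (hn : n ≠ 0) (m : ℕ) :
    (rres id f (n : ℕ∞) = (m : ℕ∞) ↔
      m ≠ 0 ∧ f ((m - 1 : ℕ) : ℕ∞) < (n : ℕ∞) ∧ (n : ℕ∞) ≤ f (m : ℕ∞)) ∧
    (rres id f (n : ℕ∞) = ⊤ ↔ f ⊤ < (n : ℕ∞)) ∧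
    (rres id f ⊤ = (m : ℕ∞) ↔
      f (m : ℕ∞) = ⊤ ∧ ∃ k : ℕ, rres id f (k : ℕ∞) = (m : ℕ∞)) ∧
    (rres id f ⊤ = ⊤ ↔
      f ⊤ < ⊤ ∨ (f ⊤ = ⊤ ∧ ∀ k : ℕ, f (k : ℕ∞) < ⊤)) := by
  obtain ⟨hmono, h0, -⟩ := id hf
  refine ⟨rres_id_eq_coe_iff hmono h0 (by exact_mod_cast hn) m, ?_, ?_, ?_⟩
  · rw [rres_id_eq_top_iff hmono, ← not_le, hf.coe_le_apply_top_iff hn]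
    push Not
    rfl
  · rw [rres_id_eq_coe_iff hmono h0 ENat.top_ne_zero, top_le_iff]
    constructor
    · rintro ⟨hm, hlt, htop⟩
      obtain ⟨j, hj⟩ := ENat.ne_top_iff_exists.mp hlt.ne
      refine ⟨htop, j + 1, (rres_id_eq_coe_iff hmono h0 (by simp) m).mpr ⟨hm, ?_, ?_⟩⟩
      · rw [← hj]
        exact_mod_cast j.lt_succ_self
      · simp [htop]
    · rintro ⟨htop, k, hk⟩
      have hm : m ≠ 0 := by
        rintro rfl
        simp [h0] at htop
      have hk0 : (k : ℕ∞) ≠ 0 := by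
        intro hk0
        have hle := (rres_id_le_coe_iff hmono (k : ℕ∞) 0).mpr (by simp [hk0])
        rw [hk] at hle
        exact hm (Nat.le_zero.mp (by exact_mod_cast hle))
      have h := (rres_id_eq_coe_iff hmono h0 hk0 m).mp hk
      exact ⟨hm, h.2.1.trans_le le_top, htop⟩
  · rw [rres_id_eq_top_iff hmono]
    constructor
    · intro h
      rcases lt_or_eq_of_le (le_top : f ⊤ ≤ ⊤) with htop | htop
      · exact Or.inl htop
      · exact Or.inr ⟨htop, h⟩
    · rintro (h | ⟨-, h⟩) k
      · exact (hmono le_top).trans_lt h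
      · exact h k
end

section
/- For any time warps f and g: last(f ∘ g) = ∞ if and only if last(f) = ∞ and last(g) = ∞. -/
theorem lastTW_eq_top_iff {f : ℕ∞ → ℕ∞} : lastTW f = ⊤ ↔ ∀ n : ℕ, f n ≠ f ⊤ := by
  unfold lastTW
  rw [sInf_eq_top]
  refine ⟨fun h n hn => ENat.natCast_ne_top n (h _ hn), fun h p hp => ?_⟩
  induction p with
  | top => rfl
  | coe n => exact absurd hp (h n)

theorem IsTimeWarp.map_top_of_lastTW_eq_top {f : ℕ∞ → ℕ∞} (hf : IsTimeWarp f)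
    (h : lastTW f = ⊤) : f ⊤ = ⊤ := by
  by_contra htop
  rw [hf.2.2] at htop
  obtain ⟨n, hn⟩ := ENat.exists_eq_iSup_of_lt_top (lt_top_iff_ne_top.2 htop)
  exact lastTW_eq_top_iff.1 h n (hn.trans hf.2.2.symm)

theorem IsTimeWarp.exists_nat_le_of_map_top {f : ℕ∞ → ℕ∞} (hf : IsTimeWarp f)
    (h : f ⊤ = ⊤) (n : ℕ) : ∃ m : ℕ, (n : ℕ∞) ≤ f m := by
  have hn : (n : ℕ∞) < ⨆ m : ℕ, f m := by
    rw [← hf.2.2, h]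
    exact ENat.natCast_lt_top n
  obtain ⟨m, hm⟩ := lt_iSup_iff.1 hn
  exact ⟨m, hm.le⟩

theorem stmt16 (f g : ℕ∞ → ℕ∞) (hf : IsTimeWarp f) (hg : IsTimeWarp g) :
    lastTW (f ∘ g) = ⊤ ↔ lastTW f = ⊤ ∧ lastTW g = ⊤ := by
  constructor
  · intro h
    have hfg := lastTW_eq_top_iff.1 h
    have hlast : lastTW g = ⊤ :=
      lastTW_eq_top_iff.2 fun n hn => hfg n (congrArg f hn)
    have hgtop := hg.map_top_of_lastTW_eq_top hlast
    refine ⟨lastTW_eq_top_iff.2 fun n hn => ?_, hlast⟩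
    obtain ⟨m, hm⟩ := hg.exists_nat_le_of_map_top hgtop n
    apply hfg m
    simp only [Function.comp_apply, hgtop]
    exact le_antisymm (hf.1 le_top) (hn ▸ hf.1 hm)
  · rintro ⟨hlf, hlg⟩
    have hgtop := hg.map_top_of_lastTW_eq_top hlg
    refine lastTW_eq_top_iff.2 fun n hn => ?_
    have hgn : g n ≠ ⊤ := hgtop ▸ lastTW_eq_top_iff.1 hlg n
    obtain ⟨k, hk⟩ := ENat.ne_top_iff_exists.1 hgn
    simp only [Function.comp_apply, hgtop, ← hk] at hn
    exact lastTW_eq_top_iff.1 hlf k hn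
end

section
/- Let D be a finite subset of ℕ∞ × ℕ∞ such that (i) for all (i₁, j₁), (i₂, j₂) ∈ D, if i₁ ≤ i₂ then j₁ ≤ j₂, and (ii) for all (i, j) ∈ D, if i = 0 then j = 0. Then there exists a time warp f such that f i = j for every (i, j) ∈ D. Moreover, if additionally every (i, j) ∈ D with i < ∞ satisfies j < ∞, and every (i, j) ∈ D with i = ∞ satisfies j = ∞, then f can be chosen so that f p < f ∞ for every p ∈ ℕ∞ with p < ∞ (i.e., last(f) = ∞). -/
/-- The least value that `D` attains at an index `≥ p`, or `⊤` if there is none. -/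
noncomputable def upperEnvelope (D : Finset (ℕ∞ × ℕ∞)) (p : ℕ∞) : ℕ∞ :=
  D.inf fun d => if p ≤ d.1 then d.2 else ⊤

/-- The greatest value that `D` attains at an index `≤ p`, or `0` if there is none. -/
noncomputable def lowerEnvelope (D : Finset (ℕ∞ × ℕ∞)) (p : ℕ∞) : ℕ∞ :=
  D.sup fun d => if d.1 ≤ p then d.2 else 0

theorem upperEnvelope_mono (D : Finset (ℕ∞ × ℕ∞)) : Monotone (upperEnvelope D) := by
  intro p q hpq
  refine Finset.inf_mono_fun fun d _ => ?_
  by_cases hq : q ≤ d.1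
  · simp [hq, hpq.trans hq]
  · simp [hq]

theorem lowerEnvelope_mono (D : Finset (ℕ∞ × ℕ∞)) : Monotone (lowerEnvelope D) := by
  intro p q hpq
  refine Finset.sup_mono_fun fun d _ => ?_
  by_cases hp : d.1 ≤ p
  · simp [hp, hp.trans hpq]
  · simp [hp]

theorem upperEnvelope_eq {D : Finset (ℕ∞ × ℕ∞)}
    (hmon : ∀ p ∈ D, ∀ q ∈ D, p.1 ≤ q.1 → p.2 ≤ q.2) {d : ℕ∞ × ℕ∞} (hd : d ∈ D) :
    upperEnvelope D d.1 = d.2 := by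
  apply le_antisymm
  · exact (Finset.inf_le hd).trans (by simp)
  · refine Finset.le_inf fun e he => ?_
    split_ifs with h
    · exact hmon d hd e he h
    · exact le_top

theorem le_lowerEnvelope {D : Finset (ℕ∞ × ℕ∞)} {d : ℕ∞ × ℕ∞} (hd : d ∈ D) :
    d.2 ≤ lowerEnvelope D d.1 := by
  have h := Finset.le_sup (f := fun e : ℕ∞ × ℕ∞ => if e.1 ≤ d.1 then e.2 else 0) hd
  simpa [lowerEnvelope] using h

theorem lowerEnvelope_zero {D : Finset (ℕ∞ × ℕ∞)} (hzero : ∀ p ∈ D, p.1 = 0 → p.2 = 0) :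
    lowerEnvelope D 0 = 0 := by
  refine le_antisymm (Finset.sup_le fun d hd => ?_) bot_le
  split_ifs with h
  · exact (hzero d hd (le_antisymm h bot_le)).le
  · exact le_rfl

theorem lowerEnvelope_lt_top {D : Finset (ℕ∞ × ℕ∞)} (hfin : ∀ p ∈ D, p.1 < ⊤ → p.2 < ⊤)
    {q : ℕ∞} (hq : q < ⊤) : lowerEnvelope D q < ⊤ := by
  refine (Finset.sup_lt_iff (by simp)).2 fun d hd => ?_
  split_ifs with h
  · exact hfin d hd (h.trans_lt hq)
  · simp

theorem upperEnvelope_top {D : Finset (ℕ∞ × ℕ∞)} (htop : ∀ p ∈ D, p.1 = ⊤ → p.2 = ⊤) :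
    upperEnvelope D ⊤ = ⊤ := by
  refine top_le_iff.1 (Finset.le_inf fun d hd => ?_)
  split_ifs with h
  · exact (htop d hd (top_le_iff.1 h)).ge
  · exact le_rfl

theorem exists_upperEnvelope_eq_top (D : Finset (ℕ∞ × ℕ∞)) :
    ∃ N : ℕ, ∀ n : ℕ, N ≤ n → upperEnvelope D n = upperEnvelope D ⊤ := by
  refine ⟨D.sup (fun d => d.1.toNat) + 1, fun n hn => Finset.inf_congr rfl fun d hd => ?_⟩
  have hle : d.1.toNat ≤ D.sup (fun d => d.1.toNat) :=
    Finset.le_sup (f := fun d : ℕ∞ × ℕ∞ => d.1.toNat) hd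
  obtain ⟨i, j⟩ := d
  cases i with
  | top => simp
  | coe i =>
    have : ¬ n ≤ i := by
      simp only [ENat.toNat_natCast] at hle
      omega
    simp [this]

/-- Capping the upper envelope of `D` by a function that tends to `⊤` gives a time warp. -/
theorem isTimeWarp_upperEnvelope_inf (D : Finset (ℕ∞ × ℕ∞)) {h : ℕ∞ → ℕ∞} (hm : Monotone h)
    (h0 : h 0 = 0) (hsup : ⨆ n : ℕ, h n = ⊤) :
    IsTimeWarp fun p => upperEnvelope D p ⊓ h p := by
  have hmono : Monotone fun p => upperEnvelope D p ⊓ h p := (upperEnvelope_mono D).inf hm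
  refine ⟨hmono, by simp [h0], le_antisymm ?_ (iSup_le fun n => hmono le_top)⟩
  obtain ⟨N, hN⟩ := exists_upperEnvelope_eq_top D
  calc upperEnvelope D ⊤ ⊓ h ⊤ ≤ upperEnvelope D ⊤ ⊓ ⨆ n : ℕ, h n := by simp [hsup]
    _ = ⨆ n : ℕ, upperEnvelope D ⊤ ⊓ h n := inf_iSup_eq _ _
    _ ≤ ⨆ n : ℕ, upperEnvelope D n ⊓ h n := iSup_le fun n => by
      refine le_iSup_of_le (max n N) ?_
      rw [hN _ (le_max_right n N)]
      exact inf_le_inf_left _ (hm (by exact_mod_cast le_max_left n N))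

theorem upperEnvelope_inf_eq {D : Finset (ℕ∞ × ℕ∞)}
    (hmon : ∀ p ∈ D, ∀ q ∈ D, p.1 ≤ q.1 → p.2 ≤ q.2) {h : ℕ∞ → ℕ∞}
    (hD : ∀ d ∈ D, d.2 ≤ h d.1) : ∀ d ∈ D, upperEnvelope D d.1 ⊓ h d.1 = d.2 := by
  intro d hd
  rw [upperEnvelope_eq hmon hd, inf_eq_left]
  exact hD d hd

theorem twTop_mono : Monotone twTop := by
  intro p q hpq
  by_cases hp : p = 0
  · simp [twTop, hp]
  · have hq : q ≠ 0 := fun hq => hp (le_antisymm (hpq.trans hq.le) bot_le)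
    simp [twTop, hq]

theorem iSup_twTop : ⨆ n : ℕ, twTop n = ⊤ :=
  top_le_iff.1 (le_iSup_of_le 1 (by simp [twTop]))

theorem stmt19 (D : Finset (ℕ∞ × ℕ∞))
    (hmon : ∀ p ∈ D, ∀ q ∈ D, p.1 ≤ q.1 → p.2 ≤ q.2)
    (hzero : ∀ p ∈ D, p.1 = 0 → p.2 = 0) :
    (∃ f : ℕ∞ → ℕ∞, IsTimeWarp f ∧ ∀ p ∈ D, f p.1 = p.2) ∧
    ((∀ p ∈ D, p.1 < ⊤ → p.2 < ⊤) → (∀ p ∈ D, p.1 = ⊤ → p.2 = ⊤) →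
      ∃ f : ℕ∞ → ℕ∞, IsTimeWarp f ∧ (∀ p ∈ D, f p.1 = p.2) ∧
        ∀ q : ℕ∞, q < ⊤ → f q < f ⊤) := by
  refine ⟨⟨_, isTimeWarp_upperEnvelope_inf D twTop_mono (by simp [twTop]) iSup_twTop,
    upperEnvelope_inf_eq hmon fun d hd => ?_⟩, fun hfin htop => ?_⟩
  · by_cases h : d.1 = 0
    · simp [hzero d hd h]
    · simp [twTop, h]
  · have hsup : ⨆ n : ℕ, (lowerEnvelope D n + (n : ℕ∞)) = ⊤ := by
      refine top_le_iff.1 ?_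
      rw [← ENat.iSup_natCast]
      exact iSup_mono fun n => le_add_self
    refine ⟨fun p => upperEnvelope D p ⊓ (lowerEnvelope D p + p),
      isTimeWarp_upperEnvelope_inf D ((lowerEnvelope_mono D).add monotone_id)
        (by simp [lowerEnvelope_zero hzero]) hsup,
      upperEnvelope_inf_eq (h := fun p => lowerEnvelope D p + p) hmon
        fun d hd => (le_lowerEnvelope hd).trans le_self_add,
      fun q hq => ?_⟩
    simp only [upperEnvelope_top htop, add_top, inf_top_eq]
    exact inf_le_right.trans_lt (WithTop.add_lt_top.2 ⟨lowerEnvelope_lt_top hfin hq, hq⟩)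
end
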